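/- arXiv:2302.09049 — 5 statements merged into one kernel-verified Lean document; each statement's English description precedes it below -/
import Mathlib

section
/- If the seeds satisfy σ_r = 1 for infinitely many r ∈ ℕ, then the multiperiodic sequence (k_t)_{t∈ℕ} with periods (π_r)_{r∈ℕ} and seeds (σ_r)_{r∈ℕ} is finite, i.e., k_t < ∞ for every t ∈ ℕ. -/
/-- The number of tokens among `k 1, …, k t` that are `≥ r`; when `k t ≥ r`,
this is the position of the token `k t` in the subsequence of `(k t)` obtained
by removing all tokens `< r`. -/
def mpCount (k : ℕ → ℕ∞) (r t : ℕ) : ℕ :=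
  ((Finset.Icc 1 t).filter (fun s => (r : ℕ∞) ≤ k s)).card

/-- `k` (1-indexed, with values in `ℕ ∪ {∞}`, tokens being positive) is the
multiperiodic sequence with periods `π` and seeds `σ`: for every `r ≥ 1`, in the
subsequence obtained by removing all tokens `< r`, a token equals `r` exactly at
the positions congruent to `σ r` modulo `π r`. -/
def IsMultiperiodic (π σ : ℕ → ℕ) (k : ℕ → ℕ∞) : Prop :=
  (∀ t, 1 ≤ t → 1 ≤ k t) ∧
  ∀ r : ℕ, 1 ≤ r → ∀ t : ℕ, 1 ≤ t → (r : ℕ∞) ≤ k t →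
    (k t = (r : ℕ∞) ↔ mpCount k r t % π r = σ r % π r)

/-- if `σ r = 1` for infinitely many `r`, then the multiperiodic
sequence with periods `π` and seeds `σ` is finite, i.e. `k t < ∞` for all `t`. -/
theorem multiperiodic_finite_of_infinitely_many_minimal_seeds
    (π σ : ℕ → ℕ) (hπ : ∀ r, 1 ≤ r → 1 ≤ π r)
    (hσ : ∀ r, 1 ≤ r → σ r ∈ Finset.Icc 1 (π r))
    (hinf : {r : ℕ | 1 ≤ r ∧ σ r = 1}.Infinite)
    (k : ℕ → ℕ∞) (hk : IsMultiperiodic π σ k) :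
    ∀ t, 1 ≤ t → k t ≠ ⊤ := by
  intro t
  induction t using Nat.strong_induction_on with
  | _ t ih =>
    intro ht htop
    obtain ⟨r, ⟨hr1, hσr⟩, hr⟩ :=
      hinf.exists_gt ((Finset.Icc 1 t).sup fun s => (k s).toNat)
    have hlt : ∀ s ∈ Finset.Icc 1 t, s ≠ t → k s < (r : ℕ∞) := by
      intro s hs hst
      have hs' := Finset.mem_Icc.mp hs
      have hfin : k s ≠ ⊤ := ih s (lt_of_le_of_ne hs'.2 hst) hs'.1
      have hle : (k s).toNat < r :=
        (Finset.le_sup (f := fun s => (k s).toNat) hs).trans_lt hr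
      rw [← ENat.natCast_toNat hfin]
      exact_mod_cast hle
    have hcount : mpCount k r t = 1 := by
      rw [mpCount, Finset.card_eq_one]
      refine ⟨t, Finset.ext fun s => ?_⟩
      rw [Finset.mem_filter, Finset.mem_singleton]
      constructor
      · rintro ⟨hs, hle⟩
        by_contra hst
        exact (hlt s hs hst).not_ge hle
      · rintro rfl
        exact ⟨Finset.mem_Icc.mpr ⟨ht, le_rfl⟩, by simp [htop]⟩
    have hkr : k t = (r : ℕ∞) :=
      (hk.2 r hr1 t ht (by simp [htop])).mpr (by rw [hcount, hσr])
    exact ENat.natCast_ne_top r (hkr.symm.trans htop)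
end

section
/- For the multiperiodic sequence with periods (π_r)_{r∈ℕ}, π_r ≥ 2, and minimal seeds σ_r = 1 for all r, the waiting time of type r is given by the nested-ceiling formula w_r = ⌈…⌈⌈π_{r-1}/(π_{r-1}−1)⌉ · π_{r-2}/(π_{r-2}−1)⌉ … · π_1/(π_1−1)⌉, i.e., w_r is obtained from T_r = 1 by the backward recursion T_{j-1} = ⌈T_j · π_{j-1}/(π_{j-1}−1)⌉ for j = r, r−1, …, 2, with w_r = T_1. -/
/-- Waiting time of type `r`: the first position `t ≥ 1` with `k t = r`. -/
noncomputable def mpWait (k : ℕ → ℕ∞) (r : ℕ) : ℕ :=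
  sInf {t : ℕ | 1 ≤ t ∧ k t = (r : ℕ∞)}

/-- The backward nested-ceiling recursion: `nestedCeil π r 0 = 1` (this is `T_r`)
and `nestedCeil π r (m+1) = ⌈nestedCeil π r m · π_{r-m-1}/(π_{r-m-1} − 1)⌉`
(this is `T_{r-m-1}`); the nested-ceiling expression for `w_r` is
`nestedCeil π r (r-1)` (i.e. `T_1`). -/
noncomputable def nestedCeil (π : ℕ → ℕ) (r : ℕ) : ℕ → ℕ
  | 0 => 1
  | m + 1 =>
      ⌈(nestedCeil π r m : ℚ) * (π (r - (m + 1)) : ℚ) / ((π (r - (m + 1)) : ℚ) - 1)⌉₊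

theorem mpCount_succ (k : ℕ → ℕ∞) (r t : ℕ) :
    mpCount k r (t + 1) = mpCount k r t + if (r : ℕ∞) ≤ k (t + 1) then 1 else 0 := by
  unfold mpCount
  rw [← Finset.insert_Icc_right_eq_Icc_add_one (by omega), Finset.filter_insert]
  split_ifs with h
  · rw [Finset.card_insert_of_notMem (by simp)]
  · rfl

theorem mpCount_zero (k : ℕ → ℕ∞) (r : ℕ) : mpCount k r 0 = 0 := by
  simp [mpCount]

theorem mpCount_one {k : ℕ → ℕ∞} (hk : ∀ t, 1 ≤ t → 1 ≤ k t) (t : ℕ) : mpCount k 1 t = t := by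
  unfold mpCount
  rw [Finset.filter_true_of_mem]
  · simp
  · intro s hs
    simpa using hk s (Finset.mem_Icc.mp hs).1

theorem ceilDiv_succ_eq {p : ℕ} (hp : 2 ≤ p) (n : ℕ) :
    (n + 1 + (p - 1)) / p = (n + (p - 1)) / p + if (n + 1) % p = 1 then 1 else 0 := by
  have h1 : (n + 1) % p = 1 ↔ p ∣ n := by
    have h : n + 1 ≡ 0 + 1 [MOD p] ↔ n ≡ 0 [MOD p] :=
      ⟨Nat.ModEq.add_right_cancel' 1, Nat.ModEq.add_right 1⟩
    rw [Nat.modEq_zero_iff_dvd, Nat.ModEq, zero_add, Nat.mod_eq_of_lt (show 1 < p by omega)] at h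
    exact h
  have h2 : n + 1 + (p - 1) = n + (p - 1) + 1 := by omega
  have h3 : p ∣ n + (p - 1) + 1 ↔ p ∣ n := by
    rw [show n + (p - 1) + 1 = n + p by omega]
    exact (Nat.dvd_add_left (dvd_refl p))
  rw [h2, Nat.succ_div]
  simp only [h1, h3]

theorem IsMultiperiodic.mpCount_succ_type {π : ℕ → ℕ} {k : ℕ → ℕ∞}
    (hk : IsMultiperiodic π (fun _ => 1) k) {r : ℕ} (hr : 1 ≤ r) (hπ : 2 ≤ π r) (t : ℕ) :
    mpCount k (r + 1) t + (mpCount k r t + (π r - 1)) / π r = mpCount k r t := by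
  induction t with
  | zero =>
    simp only [mpCount_zero, zero_add]
    exact Nat.div_eq_of_lt (by omega)
  | succ t ih =>
    have hcount := mpCount_succ k r t
    have hlt : ((r + 1 : ℕ) : ℕ∞) ≤ k (t + 1) ↔ (r : ℕ∞) < k (t + 1) := by
      rw [Nat.cast_add, Nat.cast_one]
      exact ENat.add_one_le_iff (ENat.natCast_ne_top r)
    simp only [mpCount_succ k (r + 1) t, hlt]
    by_cases h : (r : ℕ∞) ≤ k (t + 1)
    · have hiff := hk.2 r hr (t + 1) (by omega) h
      rw [if_pos h] at hcount
      rw [hcount, Nat.mod_eq_of_lt (show 1 < π r by omega)] at hiff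
      rw [hcount, ceilDiv_succ_eq hπ]
      by_cases he : k (t + 1) = r
      · rw [if_neg (by simp [he]), if_pos (hiff.mp he)]
        omega
      · rw [if_pos (lt_of_le_of_ne h (Ne.symm he)), if_neg (fun h' => he (hiff.mpr h'))]
        omega
    · rw [if_neg h, add_zero] at hcount
      rw [hcount, if_neg (fun h' => h h'.le), add_zero, ih]

theorem IsMultiperiodic.le_mpCount_succ_type_iff {π : ℕ → ℕ} {k : ℕ → ℕ∞}
    (hk : IsMultiperiodic π (fun _ => 1) k) {r : ℕ} (hr : 1 ≤ r) (hπ : 2 ≤ π r) (T t : ℕ) :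
    T ≤ mpCount k (r + 1) t ↔ ⌈(T : ℚ) * (π r : ℚ) / ((π r : ℚ) - 1)⌉₊ ≤ mpCount k r t := by
  have h := hk.mpCount_succ_type hr hπ t
  generalize mpCount k (r + 1) t = c' at *
  generalize mpCount k r t = c at *
  generalize π r = p at *
  obtain ⟨p, rfl⟩ : ∃ q, p = q + 1 := ⟨p - 1, by omega⟩
  have hp : (0 : ℚ) < p := by exact_mod_cast (by omega : 0 < p)
  rw [Nat.ceil_le, Nat.cast_add, Nat.cast_one, add_sub_cancel_right, div_le_iff₀ hp]
  norm_cast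
  rw [Nat.add_sub_cancel] at h
  have h1 := Nat.div_mul_le_self (c + p) (p + 1)
  have h2 := Nat.lt_div_mul_add (a := c + p) (b := p + 1) (by omega)
  generalize (c + p) / (p + 1) = q at *
  subst h
  constructor
  · intro hT
    nlinarith
  · intro hT
    by_contra! hlt
    nlinarith

theorem IsMultiperiodic.one_le_mpCount_iff {π : ℕ → ℕ} (hπ : ∀ r, 1 ≤ r → 2 ≤ π r) {k : ℕ → ℕ∞}
    (hk : IsMultiperiodic π (fun _ => 1) k) {r m : ℕ} (hm : m < r) (t : ℕ) :
    1 ≤ mpCount k r t ↔ nestedCeil π r m ≤ mpCount k (r - m) t := by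
  induction m with
  | zero => rfl
  | succ m ih =>
    have hr : 1 ≤ r - (m + 1) := by omega
    rw [ih (by omega), show r - m = r - (m + 1) + 1 by omega,
      hk.le_mpCount_succ_type_iff hr (hπ _ hr), nestedCeil]

/-- for the multiperiodic sequence with periods `π r ≥ 2` and
minimal seeds `σ r = 1`, the waiting time of type `r` is given by the
nested-ceiling formula
`w_r = ⌈…⌈⌈π_{r-1}/(π_{r-1}−1)⌉ · π_{r-2}/(π_{r-2}−1)⌉ … · π_1/(π_1−1)⌉`. -/
theorem multiperiodic_waiting_time_eq_nestedCeil
    (π : ℕ → ℕ) (hπ : ∀ r, 1 ≤ r → 2 ≤ π r)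
    (k : ℕ → ℕ∞) (hk : IsMultiperiodic π (fun _ => 1) k)
    (r : ℕ) (hr : 1 ≤ r) :
    mpWait k r = nestedCeil π r (r - 1) := by
  have key : ∀ t, 1 ≤ mpCount k r t ↔ nestedCeil π r (r - 1) ≤ t := by
    intro t
    rw [hk.one_le_mpCount_iff hπ (show r - 1 < r by omega), show r - (r - 1) = 1 by omega,
      mpCount_one hk.1]
  generalize nestedCeil π r (r - 1) = T at key
  obtain ⟨T, rfl⟩ : ∃ s, T = s + 1 := by
    have h0 := key 0
    rw [mpCount_zero] at h0
    exact ⟨T - 1, by omega⟩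
  have hcount := mpCount_succ k r T
  have h1 := (key (T + 1)).mpr le_rfl
  have h2 : mpCount k r T = 0 := by
    have := key T
    omega
  have hle : (r : ℕ∞) ≤ k (T + 1) := by
    by_contra h
    rw [if_neg h] at hcount
    omega
  rw [if_pos hle, h2, zero_add] at hcount
  have hT : k (T + 1) = r := (hk.2 r hr (T + 1) (by omega) hle).mpr (by rw [hcount])
  refine IsLeast.csInf_eq ⟨⟨by omega, hT⟩, ?_⟩
  rintro t ⟨ht, hkt⟩
  obtain ⟨t, rfl⟩ : ∃ s, t = s + 1 := ⟨t - 1, by omega⟩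
  refine (key _).mp ?_
  rw [mpCount_succ, if_pos hkt.ge]
  omega
end

section
/- For the multiperiodic sequence with periods (π_r)_{r∈ℕ}, π_r ≥ 2, and minimal seeds σ_r = 1 for all r, the number of types satisfies n_t = max{k_1, k_2, …, k_t} = max{r ∈ ℕ : w_r ≤ t} for every t ∈ ℕ; that is, whenever a type r₁ occurs by time t, every smaller type r₂ < r₁ has already occurred by time t. -/
/-- The number of distinct types among `k 1, …, k t`. -/
def mpTypes (k : ℕ → ℕ∞) (t : ℕ) : ℕ :=
  ((Finset.Icc 1 t).image k).card

/-- Two consecutive tokens that are `≥ r` have consecutive counts. -/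
theorem mpCount_succ_s4 {k : ℕ → ℕ∞} {r a b : ℕ} (hab : a < b) (hb : (r : ℕ∞) ≤ k b)
    (hgap : ∀ s, a < s → s < b → ¬ (r : ℕ∞) ≤ k s) :
    mpCount k r b = mpCount k r a + 1 := by
  unfold mpCount
  have h : (Finset.Icc 1 b).filter (fun s => (r : ℕ∞) ≤ k s)
      = insert b ((Finset.Icc 1 a).filter (fun s => (r : ℕ∞) ≤ k s)) := by
    ext s
    simp only [Finset.mem_filter, Finset.mem_Icc, Finset.mem_insert]
    constructor
    · rintro ⟨⟨h1, h2⟩, h3⟩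
      rcases h2.eq_or_lt with h2 | h2
      · exact Or.inl h2
      · exact Or.inr ⟨⟨h1, not_lt.1 fun h => hgap s h h2 h3⟩, h3⟩
    · rintro (rfl | ⟨⟨h1, h2⟩, h3⟩)
      · exact ⟨⟨by omega, le_rfl⟩, hb⟩
      · exact ⟨⟨h1, by omega⟩, h3⟩
  rw [h, Finset.card_insert_of_notMem (by simp; omega)]

/-- The next token `≥ r` after position `a` raises the count by one. -/
theorem exists_next_mpCount {k : ℕ → ℕ∞} {r a t : ℕ} (hat : a < t) (ht : (r : ℕ∞) ≤ k t) :
    ∃ b, a < b ∧ b ≤ t ∧ (r : ℕ∞) ≤ k b ∧ mpCount k r b = mpCount k r a + 1 := by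
  classical
  have hex : ∃ s, a < s ∧ (r : ℕ∞) ≤ k s := ⟨t, hat, ht⟩
  obtain ⟨h1, h2⟩ := Nat.find_spec hex
  exact ⟨Nat.find hex, h1, Nat.find_min' hex ⟨hat, ht⟩, h2,
    mpCount_succ_s4 h1 h2 fun s hs hs' hr => Nat.find_min hex hs' ⟨hs, hr⟩⟩

namespace IsMultiperiodic

variable {π : ℕ → ℕ} {k : ℕ → ℕ∞}

/-- With minimal seeds, type `r` occurs no later than any token `≥ r`. -/
theorem exists_le_eq (hk : IsMultiperiodic π (fun _ => 1) k) {r t : ℕ} (hr : 1 ≤ r)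
    (ht : 1 ≤ t) (hrt : (r : ℕ∞) ≤ k t) : ∃ s, 1 ≤ s ∧ s ≤ t ∧ k s = (r : ℕ∞) := by
  obtain ⟨b, hb, hbt, hrb, hc⟩ := exists_next_mpCount (a := 0) ht hrt
  refine ⟨b, hb, hbt, (hk.2 r hr b hb hrb).2 ?_⟩
  rw [hc]
  simp [mpCount]

/-- For periods at least two, tokens `≥ r` occur arbitrarily late. -/
theorem exists_gt_le (hπ : ∀ r, 1 ≤ r → 2 ≤ π r) (hk : IsMultiperiodic π (fun _ => 1) k)
    {r : ℕ} (hr : 1 ≤ r) : ∀ N : ℕ, ∃ t, N < t ∧ (r : ℕ∞) ≤ k t := by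
  induction r, hr using Nat.le_induction with
  | base => exact fun N => ⟨N + 1, by omega, by simpa using hk.1 (N + 1) (by omega)⟩
  | succ r hr ih =>
    intro N
    by_contra! hN
    have key : ∀ t, N < t → (r : ℕ∞) ≤ k t → mpCount k r t % π r = 1 % π r := by
      intro t ht hrt
      refine (hk.2 r hr t (by omega) hrt).1 (le_antisymm ?_ hrt)
      exact Order.le_of_lt_add_one (by simpa using hN t ht)
    obtain ⟨a, ha, hra⟩ := ih N
    obtain ⟨t, ht, hrt⟩ := ih a
    obtain ⟨b, hab, -, hrb, hc⟩ := exists_next_mpCount ht hrt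
    have h1 := key a ha hra
    have h2 := key b (by omega) hrb
    have h3 : 0 + mpCount k r a ≡ 1 + mpCount k r a [MOD π r] := by
      rw [zero_add, add_comm, ← hc]
      exact h1.trans h2.symm
    have h4 := Nat.ModEq.add_right_cancel' _ h3
    have h5 := hπ r hr
    rw [Nat.ModEq, Nat.zero_mod, Nat.mod_eq_of_lt (by omega)] at h4
    omega

/-- For periods at least two and minimal seeds, every type attains its waiting time. -/
theorem mpWait_spec (hπ : ∀ r, 1 ≤ r → 2 ≤ π r) (hk : IsMultiperiodic π (fun _ => 1) k)
    {r : ℕ} (hr : 1 ≤ r) : 1 ≤ mpWait k r ∧ k (mpWait k r) = (r : ℕ∞) := by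
  obtain ⟨t, ht, hrt⟩ := exists_gt_le hπ hk hr 0
  obtain ⟨s, hs, -, hks⟩ := hk.exists_le_eq hr ht hrt
  exact Nat.sInf_mem (s := {t : ℕ | 1 ≤ t ∧ k t = (r : ℕ∞)}) ⟨s, hs, hks⟩

/-- With minimal seeds, the token at position `t` is at most `t`. -/
theorem le_index (hk : IsMultiperiodic π (fun _ => 1) k) {t : ℕ} (ht : 1 ≤ t) :
    k t ≤ t := by
  by_contra! h
  have hsub : (Finset.Icc 1 (t + 1)).image (fun r : ℕ => (r : ℕ∞)) ⊆
      (Finset.Icc 1 t).image k := by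
    intro x hx
    obtain ⟨r, hr, rfl⟩ := Finset.mem_image.1 hx
    rw [Finset.mem_Icc] at hr
    have hrt : (r : ℕ∞) ≤ k t :=
      le_trans (by exact_mod_cast hr.2) (Order.add_one_le_of_lt h)
    obtain ⟨s, hs, hst, hks⟩ := hk.exists_le_eq hr.1 ht hrt
    exact Finset.mem_image.2 ⟨s, Finset.mem_Icc.2 ⟨hs, hst⟩, hks⟩
  have hcard := (Finset.card_le_card hsub).trans Finset.card_image_le
  rw [Finset.card_image_of_injective _ Nat.cast_injective] at hcard
  simp at hcard

/-- With minimal seeds, the number of types by time `t` is the maximal token. -/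
theorem mpTypes_eq_sup (hk : IsMultiperiodic π (fun _ => 1) k) {t : ℕ} (ht : 1 ≤ t) :
    (mpTypes k t : ℕ∞) = (Finset.Icc 1 t).sup k := by
  obtain ⟨s, hs, hmax⟩ := Finset.exists_mem_eq_sup (Finset.Icc 1 t) ⟨1, by simpa using ht⟩ k
  have hs' := Finset.mem_Icc.1 hs
  obtain ⟨m, hm⟩ := ENat.ne_top_iff_exists.1
    (ne_top_of_le_ne_top (ENat.natCast_ne_top s) (hk.le_index hs'.1))
  have himage : (Finset.Icc 1 t).image k = (Finset.Icc 1 m).image (fun r : ℕ => (r : ℕ∞)) := by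
    ext x
    simp only [Finset.mem_image]
    constructor
    · rintro ⟨u, hu, rfl⟩
      have hle : k u ≤ m := by rw [hm, ← hmax]; exact Finset.le_sup hu
      obtain ⟨r, hr⟩ := ENat.ne_top_iff_exists.1
        (ne_top_of_le_ne_top (ENat.natCast_ne_top m) hle)
      have hone := hk.1 u (Finset.mem_Icc.1 hu).1
      rw [← hr] at hle hone
      exact ⟨r, Finset.mem_Icc.2 ⟨by exact_mod_cast hone, by exact_mod_cast hle⟩, hr⟩
    · rintro ⟨r, hr, rfl⟩
      rw [Finset.mem_Icc] at hr
      have hrs : (r : ℕ∞) ≤ k s := by rw [← hm]; exact_mod_cast hr.2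
      obtain ⟨u, hu, hus, hku⟩ := hk.exists_le_eq hr.1 hs'.1 hrs
      exact ⟨u, Finset.mem_Icc.2 ⟨hu, hus.trans hs'.2⟩, hku⟩
  rw [hmax, ← hm, mpTypes, himage, Finset.card_image_of_injective _ Nat.cast_injective,
    Nat.card_Icc, Nat.add_sub_cancel]

/-- For periods at least two and minimal seeds, the types that have appeared by time `t` are
exactly those up to the number of types. -/
theorem mpWait_le_iff (hπ : ∀ r, 1 ≤ r → 2 ≤ π r) (hk : IsMultiperiodic π (fun _ => 1) k)
    {r t : ℕ} (hr : 1 ≤ r) (ht : 1 ≤ t) : mpWait k r ≤ t ↔ r ≤ mpTypes k t := by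
  obtain ⟨hw, hkw⟩ := mpWait_spec hπ hk hr
  rw [← Nat.cast_le (α := ℕ∞), ← Nat.cast_le (α := ℕ∞), hk.mpTypes_eq_sup ht, Nat.cast_le]
  constructor
  · intro h
    rw [← hkw]
    exact Finset.le_sup (Finset.mem_Icc.2 ⟨hw, h⟩)
  · intro h
    obtain ⟨s, hs, hmax⟩ :=
      Finset.exists_mem_eq_sup (Finset.Icc 1 t) ⟨1, by simpa using ht⟩ k
    rw [Finset.mem_Icc] at hs
    rw [hmax] at h
    obtain ⟨u, hu, hus, hku⟩ := hk.exists_le_eq hr hs.1 h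
    exact (Nat.sInf_le (⟨hu, hku⟩ : 1 ≤ u ∧ k u = (r : ℕ∞))).trans (hus.trans hs.2)

end IsMultiperiodic

/-- for the multiperiodic sequence with periods `π r ≥ 2` and
minimal seeds `σ r = 1`, the number of types satisfies
`n_t = max{k_1, …, k_t} = max{r ∈ ℕ : w_r ≤ t}`; that is, whenever a type `r₁`
occurs by time `t`, every smaller type `r₂ < r₁` has already occurred before. -/
theorem multiperiodic_number_of_types
    (π : ℕ → ℕ) (hπ : ∀ r, 1 ≤ r → 2 ≤ π r)
    (k : ℕ → ℕ∞) (hk : IsMultiperiodic π (fun _ => 1) k) :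
    (∀ t : ℕ, 1 ≤ t →
      (mpTypes k t : ℕ∞) = (Finset.Icc 1 t).sup k ∧
      mpTypes k t = sSup {r : ℕ | 1 ≤ r ∧ mpWait k r ≤ t}) ∧
    (∀ t₁ r₁ r₂ : ℕ, 1 ≤ t₁ → k t₁ = (r₁ : ℕ∞) → 1 ≤ r₂ → r₂ < r₁ →
      ∃ t₂ : ℕ, 1 ≤ t₂ ∧ t₂ < t₁ ∧ k t₂ = (r₂ : ℕ∞)) := by
  refine ⟨fun t ht => ⟨hk.mpTypes_eq_sup ht, ?_⟩, fun t₁ r₁ r₂ ht₁ hkt hr₂ hlt => ?_⟩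
  · have hset : {r : ℕ | 1 ≤ r ∧ mpWait k r ≤ t} = Set.Icc 1 (mpTypes k t) := by
      ext r
      exact and_congr_right fun hr => IsMultiperiodic.mpWait_le_iff hπ hk hr ht
    have hpos : 1 ≤ mpTypes k t :=
      Finset.card_pos.2 ⟨k 1, Finset.mem_image_of_mem k (by simpa using ht)⟩
    rw [hset, csSup_Icc hpos]
  · obtain ⟨s, hs, hst, hks⟩ :=
      hk.exists_le_eq hr₂ ht₁ (by rw [hkt]; exact_mod_cast hlt.le)
    refine ⟨s, hs, lt_of_le_of_ne hst ?_, hks⟩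
    rintro rfl
    rw [hks] at hkt
    exact hlt.ne (by exact_mod_cast hkt)
end

section
/- Let X and Y be real random variables with X ≥ 0 and Y ≥ 1 almost surely, and let p > 1. Then E[X log Y] ≤ (E[X^p])^{1/p} · (log E[Y] + 1/(p−1)). -/
open MeasureTheory
open scoped ENNReal

/-- The function `y ↦ (log y + c) ^ (1 + c)` is concave on `[1, ∞)`. -/
lemma concaveOn_log_add_rpow {c : ℝ} (hc : 0 < c) :
    ConcaveOn ℝ (Set.Ici 1) fun y : ℝ ↦ (Real.log y + c) ^ (1 + c) := by
  have hder : ∀ y : ℝ, 1 ≤ y → HasDerivAt (fun y : ℝ ↦ (Real.log y + c) ^ (1 + c))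
      (y⁻¹ * (1 + c) * (Real.log y + c) ^ (1 + c - 1)) y := fun y hy ↦
    ((Real.hasDerivAt_log (by positivity)).add_const c).rpow_const
      (Or.inl (by have := Real.log_nonneg hy; positivity))
  refine AntitoneOn.concaveOn_of_deriv (convex_Ici 1)
    (fun y hy ↦ (hder y hy).continuousAt.continuousWithinAt)
    (fun y hy ↦ (hder y (interior_subset hy)).differentiableAt.differentiableWithinAt) ?_
  intro x hx y hy hxy
  replace hx : 1 ≤ x := interior_subset hx
  replace hy : 1 ≤ y := interior_subset hy
  rw [(hder x hx).deriv, (hder y hy).deriv, add_sub_cancel_left]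
  have hx0 : 0 < x := by linarith
  have hy0 : 0 < y := by linarith
  have hlx := Real.log_nonneg hx
  have hly := Real.log_nonneg hy
  have hlog : Real.log x ≤ Real.log y := Real.log_le_log hx0 hxy
  have hu : 0 < Real.log x + c := by positivity
  have hv : 0 < Real.log y + c := by positivity
  have key : Real.log y⁻¹ + c * Real.log (Real.log y + c) ≤
      Real.log x⁻¹ + c * Real.log (Real.log x + c) := by
    have h1 := Real.log_le_sub_one_of_pos (div_pos hv hu)
    rw [Real.log_div hv.ne' hu.ne'] at h1
    have h2 : c * ((Real.log y + c) / (Real.log x + c) - 1) ≤ Real.log y - Real.log x := by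
      rw [div_sub_one hu.ne', mul_div_assoc', div_le_iff₀ hu]
      nlinarith
    have h3 := mul_le_mul_of_nonneg_left h1 hc.le
    rw [Real.log_inv, Real.log_inv]
    linarith
  have hmain : y⁻¹ * (Real.log y + c) ^ c ≤ x⁻¹ * (Real.log x + c) ^ c := by
    rw [← Real.log_le_log_iff (by positivity) (by positivity),
      Real.log_mul (by positivity) (by positivity), Real.log_mul (by positivity) (by positivity),
      Real.log_rpow hv, Real.log_rpow hu]
    exact key
  have := mul_le_mul_of_nonneg_left hmain (by positivity : 0 ≤ 1 + c)
  linarith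

/-- The graph of `y ↦ (log y + c) ^ (1 + c)` on `[1, ∞)` lies below its tangent lines. -/
lemma exists_log_add_rpow_le_tangent {c m : ℝ} (hc : 0 < c) (hm : 1 ≤ m) :
    ∃ b : ℝ, ∀ y, 1 ≤ y →
      (Real.log y + c) ^ (1 + c) ≤ (Real.log m + c) ^ (1 + c) + b * (y - m) := by
  have hder : HasDerivAt (fun y : ℝ ↦ (Real.log y + c) ^ (1 + c))
      (m⁻¹ * (1 + c) * (Real.log m + c) ^ (1 + c - 1)) m :=
    ((Real.hasDerivAt_log (by positivity)).add_const c).rpow_const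
      (Or.inl (by have := Real.log_nonneg hm; positivity))
  refine ⟨m⁻¹ * (1 + c) * (Real.log m + c) ^ (1 + c - 1), fun y hy ↦ ?_⟩
  rcases lt_trichotomy y m with h | h | h
  · have := (concaveOn_log_add_rpow hc).le_slope_of_hasDerivAt hy hm h hder
    rw [slope_def_field, le_div_iff₀ (by linarith)] at this
    linarith
  · simp [h]
  · have := (concaveOn_log_add_rpow hc).slope_le_of_hasDerivAt hm hy h hder
    rw [slope_def_field, div_le_iff₀ (by linarith)] at this
    linarith

/-- Jensen's inequality for `y ↦ (log y + c) ^ (1 + c)`. -/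
lemma lintegral_log_add_rpow_le {Ω : Type*} [MeasurableSpace Ω] (P : Measure Ω)
    [IsProbabilityMeasure P] {Y : Ω → ℝ} (hYint : Integrable Y P) (hY : ∀ᵐ ω ∂P, 1 ≤ Y ω)
    {c : ℝ} (hc : 0 < c) :
    ∫⁻ ω, ENNReal.ofReal (Real.log (Y ω) + c) ^ (1 + c) ∂P ≤
      ENNReal.ofReal (Real.log (∫ ω, Y ω ∂P) + c) ^ (1 + c) := by
  have hm : 1 ≤ ∫ ω, Y ω ∂P := by
    simpa using integral_mono_ae (integrable_const (1 : ℝ)) hYint hY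
  obtain ⟨b, hb⟩ := exists_log_add_rpow_le_tangent hc hm
  set m := ∫ ω, Y ω ∂P with hm_def
  have hsub : Integrable (fun ω ↦ b * (Y ω - m)) P :=
    (hYint.sub (integrable_const m)).const_mul b
  have hint : Integrable (fun ω ↦ (Real.log m + c) ^ (1 + c) + b * (Y ω - m)) P :=
    (integrable_const _).add hsub
  have hval : ∫ ω, ((Real.log m + c) ^ (1 + c) + b * (Y ω - m)) ∂P =
      (Real.log m + c) ^ (1 + c) := by
    rw [integral_add (integrable_const _) hsub,
      integral_const_mul, integral_sub hYint (integrable_const m)]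
    simp [← hm_def]
  have hnn : ∀ y : ℝ, 1 ≤ y → 0 ≤ Real.log y + c := fun y hy ↦ by
    have := Real.log_nonneg hy
    positivity
  calc ∫⁻ ω, ENNReal.ofReal (Real.log (Y ω) + c) ^ (1 + c) ∂P
      ≤ ∫⁻ ω, ENNReal.ofReal ((Real.log m + c) ^ (1 + c) + b * (Y ω - m)) ∂P := by
        refine lintegral_mono_ae ?_
        filter_upwards [hY] with ω hω
        rw [ENNReal.ofReal_rpow_of_nonneg (hnn _ hω) (by positivity)]
        exact ENNReal.ofReal_le_ofReal (hb _ hω)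
    _ = ENNReal.ofReal (Real.log m + c) ^ (1 + c) := by
        rw [← ofReal_integral_eq_lintegral_ofReal hint, hval,
          ENNReal.ofReal_rpow_of_nonneg (hnn _ hm) (by positivity)]
        filter_upwards [hY] with ω hω
        exact (Real.rpow_nonneg (hnn _ hω) _).trans (hb _ hω)

/-- if `X ≥ 0` and `Y ≥ 1` almost surely and `p > 1`, then
`E[X log Y] ≤ (E[X^p])^{1/p} · (log E[Y] + 1/(p−1))`, where the right-hand
side is `+∞` if `E[X^p] = ∞` or `E[Y] = ∞`. -/
theorem expectation_mul_log_le_holder_jensen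
    {Ω : Type*} [MeasurableSpace Ω] (P : Measure Ω) [IsProbabilityMeasure P]
    (X Y : Ω → ℝ) (hXmeas : Measurable X) (hYmeas : Measurable Y)
    (hX : ∀ᵐ ω ∂P, 0 ≤ X ω) (hY : ∀ᵐ ω ∂P, 1 ≤ Y ω)
    (p : ℝ) (hp : 1 < p) :
    (∫⁻ ω, ENNReal.ofReal (X ω * Real.log (Y ω)) ∂P) ≤
      (∫⁻ ω, ENNReal.ofReal (X ω ^ p) ∂P) ^ (1 / p) *
        (if (∫⁻ ω, ENNReal.ofReal (Y ω) ∂P) = ⊤ then ⊤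
         else ENNReal.ofReal
           (Real.log (∫⁻ ω, ENNReal.ofReal (Y ω) ∂P).toReal + 1 / (p - 1))) := by
  have hp0 : 0 < p := by linarith
  have hc : 0 < 1 / (p - 1) := one_div_pos.2 (by linarith)
  have hXp : ∫⁻ ω, ENNReal.ofReal (X ω ^ p) ∂P = ∫⁻ ω, ENNReal.ofReal (X ω) ^ p ∂P := by
    refine lintegral_congr_ae ?_
    filter_upwards [hX] with ω hω
    rw [ENNReal.ofReal_rpow_of_nonneg hω hp0.le]
  have hY0 : 0 ≤ᵐ[P] Y := by
    filter_upwards [hY] with ω hω using zero_le_one.trans hω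
  split_ifs with htop
  · by_cases h0 : ∫⁻ ω, ENNReal.ofReal (X ω ^ p) ∂P = 0
    · have hzero : ∫⁻ ω, ENNReal.ofReal (X ω * Real.log (Y ω)) ∂P = 0 := by
        rw [hXp, lintegral_eq_zero_iff (by fun_prop)] at h0
        refine (lintegral_congr_ae ?_).trans lintegral_zero
        filter_upwards [h0, hX] with ω hω hω'
        have : ENNReal.ofReal (X ω) = 0 := by simpa [hp0, hp0.not_gt] using hω
        rw [ENNReal.ofReal_mul hω', this, zero_mul]
      rw [hzero]
      exact zero_le
    · rw [ENNReal.mul_top]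
      · exact le_top
      · simp [ENNReal.rpow_eq_zero_iff, h0, hp0.not_gt]
  · have hYint : Integrable Y P := by
      refine ⟨hYmeas.aestronglyMeasurable, ?_⟩
      rw [hasFiniteIntegral_iff_ofReal hY0]
      exact lt_top_iff_ne_top.2 htop
    rw [← integral_eq_lintegral_of_nonneg_ae hY0 hYmeas.aestronglyMeasurable, hXp]
    have hpq : p.HolderConjugate (1 + 1 / (p - 1)) := by
      rw [Real.holderConjugate_iff_eq_conjExponent hp]
      have : p - 1 ≠ 0 := by linarith
      field_simp
      ring
    have hJensen := lintegral_log_add_rpow_le P hYint hY hc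
    set c := 1 / (p - 1)
    have hq : 0 < 1 + c := by positivity
    calc ∫⁻ ω, ENNReal.ofReal (X ω * Real.log (Y ω)) ∂P
        ≤ ∫⁻ ω, ((fun ω ↦ ENNReal.ofReal (X ω)) *
            fun ω ↦ ENNReal.ofReal (Real.log (Y ω) + c)) ω ∂P := by
          refine lintegral_mono_ae ?_
          filter_upwards [hX] with ω hω
          rw [Pi.mul_apply, ENNReal.ofReal_mul hω]
          gcongr
          linarith
      _ ≤ (∫⁻ ω, ENNReal.ofReal (X ω) ^ p ∂P) ^ (1 / p) *
            (∫⁻ ω, ENNReal.ofReal (Real.log (Y ω) + c) ^ (1 + c) ∂P) ^ (1 / (1 + c)) :=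
          ENNReal.lintegral_mul_le_Lp_mul_Lq P hpq (by fun_prop)
            ((hYmeas.log.add_const c).ennreal_ofReal.aemeasurable)
      _ ≤ _ := by
          gcongr
          rw [one_div, ENNReal.rpow_inv_le_iff hq]
          exact hJensen
end

section
/- Let Y be a real random variable with Y ≥ 1 almost surely and let q > 1. Then E[(log Y)^q] ≤ (log E[Y] + (q−1))^q. -/
open MeasureTheory
open scoped ENNReal

/-- The map `t ↦ t ^ c * exp (-t)` is antitone for `t ≥ c`. -/
lemma rpow_le_rpow_mul_exp_sub {c s t : ℝ} (hc : 0 < c) (hs : c ≤ s) (hst : s ≤ t) :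
    t ^ c ≤ s ^ c * Real.exp (t - s) := by
  have hs0 : 0 < s := hc.trans_le hs
  have ht0 : 0 < t := hs0.trans_le hst
  have hlog : Real.log t - Real.log s ≤ (t - s) / s := by
    rw [← Real.log_div ht0.ne' hs0.ne', sub_div, div_self hs0.ne']
    exact Real.log_le_sub_one_of_pos (div_pos ht0 hs0)
  have hle : (Real.log t - Real.log s) * c ≤ t - s := by
    calc (Real.log t - Real.log s) * c ≤ (t - s) / s * c := by gcongr
      _ ≤ (t - s) / s * s := by
        have : 0 ≤ (t - s) / s := div_nonneg (sub_nonneg.2 hst) hs0.le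
        gcongr
      _ = t - s := div_mul_cancel₀ _ hs0.ne'
  rw [Real.rpow_def_of_pos ht0, Real.rpow_def_of_pos hs0, ← Real.exp_add]
  exact Real.exp_le_exp.2 (by linarith)

/-- The tangent line inequality at `exp s` for the function `y ↦ (log y) ^ q`, which is concave
for `log y ≥ q - 1`, written in terms of `t = log y`. -/
lemma rpow_le_rpow_add_mul_exp_sub_one {q s t : ℝ} (hq : 1 < q) (hs : q - 1 ≤ s)
    (ht : q - 1 ≤ t) :
    t ^ q ≤ s ^ q + q * s ^ (q - 1) * (Real.exp (t - s) - 1) := by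
  have hc : 0 < q - 1 := sub_pos.2 hq
  let F : ℝ → ℝ := fun x ↦ q * s ^ (q - 1) * Real.exp (x - s) - x ^ q
  have hF (x : ℝ) : HasDerivAt F
      (q * s ^ (q - 1) * Real.exp (x - s) - q * x ^ (q - 1)) x := by
    have h₁ : HasDerivAt (fun y ↦ Real.exp (y - s)) (Real.exp (x - s)) x := by
      simpa using ((hasDerivAt_id x).sub_const s).exp
    exact (h₁.const_mul _).sub (Real.hasDerivAt_rpow_const (Or.inr hq.le))
  have hcont : Continuous F := continuous_iff_continuousAt.2 fun x ↦ (hF x).continuousAt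
  have key : F s ≤ F t := by
    rcases le_total s t with hst | hts
    · refine monotoneOn_of_hasDerivWithinAt_nonneg (convex_Ici s) hcont.continuousOn
        (fun x _ ↦ (hF x).hasDerivWithinAt) (fun x hx ↦ ?_) Set.self_mem_Ici hst hst
      have hx' : s ≤ x := interior_subset hx
      have := mul_le_mul_of_nonneg_left (rpow_le_rpow_mul_exp_sub hc hs hx')
        (zero_lt_one.trans hq).le
      linarith
    · refine antitoneOn_of_hasDerivWithinAt_nonpos (convex_Icc (q - 1) s) hcont.continuousOn
        (fun x _ ↦ (hF x).hasDerivWithinAt) (fun x hx ↦ ?_) ⟨ht, hts⟩ ⟨hs, le_rfl⟩ hts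
      have hx' : x ∈ Set.Icc (q - 1) s := interior_subset hx
      have h₁ : s ^ (q - 1) * Real.exp (x - s) ≤ x ^ (q - 1) := by
        calc s ^ (q - 1) * Real.exp (x - s)
            ≤ x ^ (q - 1) * Real.exp (s - x) * Real.exp (x - s) := by
              gcongr
              exact rpow_le_rpow_mul_exp_sub hc hx'.1 hx'.2
          _ = x ^ (q - 1) := by rw [mul_assoc, ← Real.exp_add]; simp
      have := mul_le_mul_of_nonneg_left h₁ (zero_lt_one.trans hq).le
      linarith
  simp only [F, sub_self, Real.exp_zero] at key
  linarith

/-- if `Y ≥ 1` almost surely and `q > 1`, then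
`E[(log Y)^q] ≤ (log E[Y] + (q−1))^q`, where the right-hand side is `+∞`
if `E[Y] = ∞`. -/
theorem expectation_log_pow_le_jensen
    {Ω : Type*} [MeasurableSpace Ω] (P : Measure Ω) [IsProbabilityMeasure P]
    (Y : Ω → ℝ) (hYmeas : Measurable Y) (hY : ∀ᵐ ω ∂P, 1 ≤ Y ω)
    (q : ℝ) (hq : 1 < q) :
    (∫⁻ ω, ENNReal.ofReal (Real.log (Y ω) ^ q) ∂P) ≤
      (if (∫⁻ ω, ENNReal.ofReal (Y ω) ∂P) = ⊤ then ⊤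
       else ENNReal.ofReal
         ((Real.log (∫⁻ ω, ENNReal.ofReal (Y ω) ∂P).toReal + (q - 1)) ^ q)) := by
  split_ifs with htop
  · exact le_top
  have hc : 0 < q - 1 := sub_pos.2 hq
  have hY0 : 0 ≤ᵐ[P] Y := hY.mono fun ω hω ↦ zero_le_one.trans hω
  have hint : Integrable Y P :=
    (lintegral_ofReal_ne_top_iff_integrable hYmeas.aestronglyMeasurable hY0).1 htop
  rw [← integral_eq_lintegral_of_nonneg_ae hY0 hYmeas.aestronglyMeasurable]
  set m := ∫ ω, Y ω ∂P with hm
  have hm1 : 1 ≤ m := by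
    simpa using integral_mono_ae (integrable_const (1 : ℝ)) hint hY
  have hm0 : 0 < m := zero_lt_one.trans_le hm1
  set L := Real.log m + (q - 1) with hL
  have hLc : q - 1 ≤ L := by linarith [Real.log_nonneg hm1]
  let G : Ω → ℝ := fun ω ↦ L ^ q + q * L ^ (q - 1) * (Y ω / m - 1)
  have hle : ∀ᵐ ω ∂P, Real.log (Y ω) ^ q ≤ G ω := by
    filter_upwards [hY] with ω hω
    have hlog := Real.log_nonneg hω
    have hexp : Real.exp (Real.log (Y ω) + (q - 1) - L) = Y ω / m := by
      rw [hL, add_sub_add_right_eq_sub, Real.exp_sub, Real.exp_log (zero_lt_one.trans_le hω),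
        Real.exp_log hm0]
    have htangent := rpow_le_rpow_add_mul_exp_sub_one hq hLc
      (t := Real.log (Y ω) + (q - 1)) (by linarith)
    rw [hexp] at htangent
    exact (Real.rpow_le_rpow hlog (by linarith) (by linarith)).trans htangent
  have hGnonneg : 0 ≤ᵐ[P] G := by
    filter_upwards [hY, hle] with ω hω h
    exact (Real.rpow_nonneg (Real.log_nonneg hω) q).trans h
  have hdiv : Integrable (fun ω ↦ Y ω / m - 1) P := (hint.div_const m).sub (integrable_const 1)
  have hGint : Integrable G P := (integrable_const _).add (hdiv.const_mul _)
  have hGval : ∫ ω, G ω ∂P = L ^ q := by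
    rw [integral_add (integrable_const _) (hdiv.const_mul _), integral_const_mul,
      integral_sub (hint.div_const m) (integrable_const 1), integral_div, ← hm, div_self hm0.ne']
    simp
  calc ∫⁻ ω, ENNReal.ofReal (Real.log (Y ω) ^ q) ∂P
      ≤ ∫⁻ ω, ENNReal.ofReal (G ω) ∂P :=
        lintegral_mono_ae (hle.mono fun ω h ↦ ENNReal.ofReal_le_ofReal h)
    _ = ENNReal.ofReal (L ^ q) := by
        rw [← ofReal_integral_eq_lintegral_ofReal hGint hGnonneg, hGval]
end
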